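/- arXiv:2205.07717 — 2 statements merged into one kernel-verified Lean document; each statement's English description precedes it below -/
import Mathlib

section
/- Let k ≥ 1 be an integer and c ∈ ℂ. For every f ∈ L²(ℂ, e^{−|z|²}) there exists a weak solution u ∈ L²(ℂ, e^{−|z|²}) of the equation ∂^k ∂̄^k u + c u = f satisfying the norm estimate ∫_ℂ |u|² e^{−|z|²} dσ ≤ (1/(k!)²) ∫_ℂ |f|² e^{−|z|²} dσ. -/
open MeasureTheory Complex Finset

/-- Wirtinger derivative ∂ = (1/2)(∂/∂x − i ∂/∂y). -/
noncomputable def wD (f : ℂ → ℂ) : ℂ → ℂ :=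
  fun z => (1 / 2 : ℂ) * (fderiv ℝ f z 1 - Complex.I * fderiv ℝ f z Complex.I)

/-- Conjugate Wirtinger derivative ∂̄ = (1/2)(∂/∂x + i ∂/∂y). -/
noncomputable def wDbar (f : ℂ → ℂ) : ℂ → ℂ :=
  fun z => (1 / 2 : ℂ) * (fderiv ℝ f z 1 + Complex.I * fderiv ℝ f z Complex.I)

/-- The operator ∂^k ∂̄^k. -/
noncomputable def Dk (k : ℕ) (f : ℂ → ℂ) : ℂ → ℂ := wD^[k] (wDbar^[k] f)

/-- Membership in the weighted space L²(ℂ, e^{−φ}): f is (a.e. strongly) measurable,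
locally square-integrable, and ∫ |f|² e^{−φ} < ∞. -/
def MemL2w (φ : ℂ → ℝ) (f : ℂ → ℂ) : Prop :=
  AEStronglyMeasurable f volume ∧
  LocallyIntegrable (fun z => ‖f z‖ ^ 2) volume ∧
  Integrable (fun z => ‖f z‖ ^ 2 * Real.exp (-(φ z))) volume

/-- Weighted inner product ⟨f, g⟩_φ = ∫ f̄ g e^{−φ} dσ. -/
noncomputable def innerW (φ : ℂ → ℝ) (f g : ℂ → ℂ) : ℂ :=
  ∫ z, (starRingEnd ℂ) (f z) * g z * (Real.exp (-(φ z)) : ℂ)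

/-- Weighted squared norm ‖f‖_φ² = ∫ |f|² e^{−φ} dσ. -/
noncomputable def normSqW (φ : ℂ → ℝ) (f : ℂ → ℂ) : ℝ :=
  ∫ z, ‖f z‖ ^ 2 * Real.exp (-(φ z))

/-- u is a weak solution of ∂^k ∂̄^k u + c u = f. -/
def IsWeakSol (k : ℕ) (c : ℂ) (u f : ℂ → ℂ) : Prop :=
  ∀ ψ : ℂ → ℂ, ContDiff ℝ (⊤ : ℕ∞) ψ → HasCompactSupport ψ →
    (∫ z, u z * Dk k ψ z) + c * (∫ z, u z * ψ z) = ∫ z, f z * ψ z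

/-- ∂̄_φ^{k*}∂_φ^{k*} ψ = e^{φ} ∂^k ∂̄^k (ψ e^{−φ}). -/
noncomputable def adjOp (k : ℕ) (φ : ℂ → ℝ) (ψ : ℂ → ℂ) : ℂ → ℂ :=
  fun z => (Real.exp (φ z) : ℂ) * Dk k (fun w => ψ w * (Real.exp (-(φ w)) : ℂ)) z

/-- The formal adjoint (∂^k ∂̄^k + c)_φ^* ψ = ∂̄_φ^{k*}∂_φ^{k*} ψ + c̄ ψ. -/
noncomputable def adjOpC (k : ℕ) (c : ℂ) (φ : ℂ → ℝ) (ψ : ℂ → ℂ) : ℂ → ℂ :=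
  fun z => adjOp k φ ψ z + (starRingEnd ℂ) c * ψ z

section Ladder

variable {V E : Type*} [AddCommGroup V] [Module ℂ V] [NormedAddCommGroup E]
  [InnerProductSpace ℂ E]

/-- Abstract annihilation and creation operators `a`, `a'` on a space `V` mapped by `ι` into an
inner product space: `a'` is a formal adjoint of `a` and `[a, a'] = 1`. -/
structure IsLadder (ι : V →ₗ[ℂ] E) (a a' : Module.End ℂ V) : Prop where
  adjoint : ∀ x y, inner ℂ (ι (a x)) (ι y) = inner ℂ (ι x) (ι (a' y))
  comm : ∀ x, a (a' x) = a' (a x) + x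

namespace IsLadder

variable {ι : V →ₗ[ℂ] E} {a a' : Module.End ℂ V}

lemma adjoint' (h : IsLadder ι a a') (x y : V) :
    inner ℂ (ι (a' x)) (ι y) = inner ℂ (ι x) (ι (a y)) := by
  rw [← inner_conj_symm, ← h.adjoint, inner_conj_symm]

lemma adjoint_pow (h : IsLadder ι a a') (n : ℕ) (x y : V) :
    inner ℂ (ι ((a' ^ n) x)) (ι y) = inner ℂ (ι x) (ι ((a ^ n) y)) := by
  induction n generalizing x with
  | zero => rfl
  | succ n ih =>
    rw [pow_succ, pow_succ', Module.End.mul_apply, Module.End.mul_apply, ih, h.adjoint']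

lemma comm_pow (h : IsLadder ι a a') (n : ℕ) (x : V) :
    a ((a' ^ (n + 1)) x) = (a' ^ (n + 1)) (a x) + ((n : ℂ) + 1) • (a' ^ n) x := by
  induction n with
  | zero => simp [h.comm]
  | succ n ih =>
    have e (m : ℕ) (y : V) : (a' ^ (m + 1)) y = a' ((a' ^ m) y) := by
      rw [pow_succ', Module.End.mul_apply]
    rw [e (n + 1), h.comm, ih, map_add, map_smul, ← e, ← e]
    push_cast
    module

lemma norm_sq_raise (h : IsLadder ι a a') (x : V) :
    ‖ι (a' x)‖ ^ 2 = ‖ι (a x)‖ ^ 2 + ‖ι x‖ ^ 2 := by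
  have : (inner ℂ (ι (a' x)) (ι (a' x)) : ℂ) = inner ℂ (ι (a x)) (ι (a x)) + inner ℂ (ι x) (ι x) := by
    rw [h.adjoint', h.comm, map_add, inner_add_right, ← h.adjoint]
  simp only [inner_self_eq_norm_sq_to_K] at this
  exact_mod_cast this

lemma re_inner_nonneg (h : IsLadder ι a a') (n : ℕ) (x : V) :
    0 ≤ (inner ℂ (ι ((a' ^ (n + 1)) (a x))) (ι ((a' ^ n) x)) : ℂ).re := by
  induction n with
  | zero =>
    simp only [zero_add, pow_one, pow_zero, Module.End.one_apply]
    rw [h.adjoint']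
    exact inner_self_nonneg (𝕜 := ℂ)
  | succ n ih =>
    rw [pow_succ', Module.End.mul_apply, h.adjoint', h.comm_pow, map_add, map_smul,
      inner_add_right, inner_smul_right, Complex.add_re]
    refine add_nonneg (inner_self_nonneg (𝕜 := ℂ)) ?_
    have : ((n : ℂ) + 1) = (((n : ℝ) + 1 : ℝ) : ℂ) := by push_cast; rfl
    rw [this, Complex.re_ofReal_mul]
    positivity

lemma norm_sq_raise_pow_ge (h : IsLadder ι a a') (n : ℕ) (x : V) :
    ‖ι ((a' ^ (n + 1)) (a x))‖ ^ 2 + ((n : ℝ) + 1) ^ 2 * ‖ι ((a' ^ n) x)‖ ^ 2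
      + ‖ι ((a' ^ (n + 1)) x)‖ ^ 2 ≤ ‖ι ((a' ^ (n + 2)) x)‖ ^ 2 := by
  rw [pow_succ' a' (n + 1), Module.End.mul_apply, h.norm_sq_raise, h.comm_pow, map_add, map_smul,
    norm_add_sq (𝕜 := ℂ), norm_smul, inner_smul_right]
  have e : ((n : ℂ) + 1) = (((n : ℝ) + 1 : ℝ) : ℂ) := by push_cast; rfl
  have := h.re_inner_nonneg n x
  rw [e, Complex.norm_real, Real.norm_of_nonneg (by positivity)]
  simp only [RCLike.re_eq_complex_re, Complex.re_ofReal_mul]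
  have : 0 ≤ ((n : ℝ) + 1) * (inner ℂ (ι ((a' ^ (n + 1)) (a x))) (ι ((a' ^ n) x)) : ℂ).re := by
    positivity
  nlinarith

lemma factorial_mul_norm_sq_le (h : IsLadder ι a a') (n : ℕ) (x : V) :
    (n.factorial : ℝ) * ‖ι x‖ ^ 2 ≤ ‖ι ((a' ^ n) x)‖ ^ 2 := by
  induction n using Nat.twoStepInduction with
  | zero => simp
  | one => simp [h.norm_sq_raise]
  | more n ih₀ ih₁ =>
    have h₀ := h.norm_sq_raise_pow_ge n x
    have h₁ := mul_le_mul_of_nonneg_left ih₀ (sq_nonneg ((n : ℝ) + 1))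
    rw [Nat.factorial_succ] at ih₁
    rw [Nat.factorial_succ, Nat.factorial_succ]
    push_cast at ih₁ ⊢
    nlinarith [sq_nonneg ‖ι ((a' ^ (n + 1)) (a x))‖]

lemma norm_sq_lower_pow_add_le (h : IsLadder ι a a') (n : ℕ) (x : V) :
    ‖ι ((a ^ (n + 1)) x)‖ ^ 2 + ((n + 1).factorial : ℝ) * ‖ι x‖ ^ 2
      ≤ ‖ι ((a' ^ (n + 1)) x)‖ ^ 2 := by
  induction n generalizing x with
  | zero => simp [h.norm_sq_raise]
  | succ n ih =>
    have h₀ := h.norm_sq_raise_pow_ge n x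
    have h₁ := mul_le_mul_of_nonneg_left (h.factorial_mul_norm_sq_le n x) (sq_nonneg ((n : ℝ) + 1))
    have h₂ := h.factorial_mul_norm_sq_le (n + 1) x
    have h₃ := ih (a x)
    have h₄ : 0 ≤ ((n + 1).factorial : ℝ) * ‖ι (a x)‖ ^ 2 := by positivity
    rw [← Module.End.mul_apply, ← pow_succ] at h₃
    rw [Nat.factorial_succ] at h₂
    rw [Nat.factorial_succ, Nat.factorial_succ]
    push_cast at h₂ ⊢
    nlinarith

/-- Two commuting ladders: `‖(a'ᵏ b'ᵏ + c) x‖ ≥ k! ‖x‖`. -/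
theorem factorial_mul_norm_le {b b' : Module.End ℂ V} (ha : IsLadder ι a a')
    (hb : IsLadder ι b b') (hab : Commute a b') {k : ℕ} (hk : 1 ≤ k) (c : ℂ) (x : V) :
    (k.factorial : ℝ) * ‖ι x‖ ≤ ‖ι ((a' ^ k) ((b' ^ k) x) + c • x)‖ := by
  obtain ⟨n, rfl⟩ := Nat.exists_eq_add_of_le' hk
  set k := n + 1
  have h₁ := ha.norm_sq_lower_pow_add_le n ((b' ^ k) x)
  have h₂ := hb.norm_sq_lower_pow_add_le n ((a ^ k) x)
  have h₃ := mul_le_mul_of_nonneg_left (hb.norm_sq_lower_pow_add_le n x)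
    (Nat.cast_nonneg (α := ℝ) k.factorial)
  have hc : (a ^ k) ((b' ^ k) x) = (b' ^ k) ((a ^ k) x) :=
    LinearMap.congr_fun (hab.pow_pow k k) x
  rw [hc] at h₁
  have hI : (inner ℂ (ι ((a' ^ k) ((b' ^ k) x))) (c • ι x) : ℂ).re
      = (inner ℂ (ι ((b ^ k) ((a ^ k) x))) (starRingEnd ℂ c • ι x) : ℂ).re := by
    rw [inner_smul_right, ha.adjoint_pow, hb.adjoint_pow, inner_smul_right,
      ← inner_conj_symm (ι ((b ^ k) ((a ^ k) x))), ← map_mul, Complex.conj_re]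
  have h₄ : 0 ≤ ‖ι ((b ^ k) ((a ^ k) x)) + starRingEnd ℂ c • ι x‖ ^ 2 := by positivity
  rw [norm_add_sq (𝕜 := ℂ), norm_smul, RCLike.norm_conj] at h₄
  refine le_of_sq_le_sq ?_ (norm_nonneg _)
  rw [map_add, map_smul, norm_add_sq (𝕜 := ℂ), norm_smul]
  simp only [RCLike.re_eq_complex_re] at *
  rw [hI]
  have p₁ : 0 ≤ (k.factorial : ℝ) * ‖ι ((a ^ k) x)‖ ^ 2 := by positivity
  have p₂ : 0 ≤ (k.factorial : ℝ) * ‖ι ((b ^ k) x)‖ ^ 2 := by positivity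
  nlinarith

end IsLadder

lemma neg_pow_apply (A : Module.End ℂ V) (k : ℕ) (x : V) :
    ((-A) ^ k) x = (-1 : ℂ) ^ k • (A ^ k) x := by
  induction k generalizing x with
  | zero => simp
  | succ k ih =>
    rw [pow_succ, Module.End.mul_apply, ih, LinearMap.neg_apply, map_neg, pow_succ, pow_succ,
      Module.End.mul_apply]
    simp

/-- Riesz representation of a functional `l` dominated by `C ‖T ·‖`. -/
theorem exists_inner_eq_of_norm_le [CompleteSpace E] (T : V →ₗ[ℂ] E) (l : V →ₗ[ℂ] ℂ) {C : ℝ}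
    (hC : 0 ≤ C) (h : ∀ x, ‖l x‖ ≤ C * ‖T x‖) :
    ∃ v : E, ‖v‖ ≤ C ∧ ∀ x, inner ℂ v (T x) = l x := by
  obtain ⟨g, hg⟩ : ∃ g : T.range →ₗ[ℂ] ℂ, g ∘ₗ T.rangeRestrict = l := by
    obtain ⟨r, hr⟩ := T.rangeRestrict.exists_rightInverse_of_surjective T.range_rangeRestrict
    refine ⟨l ∘ₗ r, LinearMap.ext fun x => sub_eq_zero.1 (norm_le_zero_iff.1 ?_)⟩
    have hx : T (r (T.rangeRestrict x)) = T x :=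
      congrArg Subtype.val (LinearMap.congr_fun hr (T.rangeRestrict x))
    have := h (r (T.rangeRestrict x) - x)
    rw [map_sub, map_sub, hx, sub_self, norm_zero, mul_zero] at this
    exact this
  let G := g.mkContinuous C (by
    rintro ⟨_, x, rfl⟩
    have := LinearMap.congr_fun hg x
    exact this ▸ h x)
  obtain ⟨F, hF, hn⟩ := exists_extension_norm_eq _ G
  refine ⟨(InnerProductSpace.toDual ℂ E).symm F, ?_, fun x => ?_⟩
  · rw [LinearIsometryEquiv.norm_map, hn]
    exact g.mkContinuous_norm_le hC _
  · rw [InnerProductSpace.toDual_symm_apply, ← hg]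
    exact hF ⟨T x, x, rfl⟩

end Ladder
section Wirtinger

open scoped ComplexConjugate

/-- The operator `(∂/∂x + s ∂/∂y) / 2`, equal to `∂` for `s = -i` and to `∂̄` for `s = i`. -/
noncomputable def wirtinger (s : ℂ) (f : ℂ → ℂ) : ℂ → ℂ :=
  fun z => (1 / 2 : ℂ) * (fderiv ℝ f z 1 + s * fderiv ℝ f z Complex.I)

lemma wD_eq_wirtinger : wD = wirtinger (-Complex.I) := by
  ext f z; simp [wD, wirtinger, sub_eq_add_neg]

lemma wDbar_eq_wirtinger : wDbar = wirtinger Complex.I := rfl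

/-- The function `z ↦ z̄` or `z ↦ z` (for `t = i`, `t = -i`) arising as the logarithmic
derivative of the Gaussian weight. -/
noncomputable def gaussianSymbol (t : ℂ) (z : ℂ) : ℂ :=
  (1 / 2 : ℂ) * (1 + conj t * Complex.I) * conj z + (1 / 2 : ℂ) * (1 - conj t * Complex.I) * z

/-- The Gaussian weight `e^{-|z|²}`. -/
noncomputable def gaussianWeight (z : ℂ) : ℂ := (Real.exp (-‖z‖ ^ 2) : ℂ)

lemma contDiff_gaussianSymbol (t : ℂ) : ContDiff ℝ (⊤ : ℕ∞) (gaussianSymbol t) := by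
  have : ContDiff ℝ (⊤ : ℕ∞) (fun z : ℂ => conj z) := Complex.conjCLE.contDiff
  unfold gaussianSymbol
  fun_prop

lemma contDiff_ofReal_exp_mul_norm_sq (r : ℝ) :
    ContDiff ℝ (⊤ : ℕ∞) (fun z : ℂ => (Real.exp (r * ‖z‖ ^ 2) : ℂ)) :=
  Complex.ofRealCLM.contDiff.comp
    (Real.contDiff_exp.comp (contDiff_const.mul (contDiff_norm_sq ℝ)))

lemma contDiff_gaussianWeight : ContDiff ℝ (⊤ : ℕ∞) gaussianWeight := by
  convert contDiff_ofReal_exp_mul_norm_sq (-1) using 3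
  simp [gaussianWeight]

lemma wirtinger_mul {f g : ℂ → ℂ} {z : ℂ} (s : ℂ) (hf : DifferentiableAt ℝ f z)
    (hg : DifferentiableAt ℝ g z) :
    wirtinger s (fun w => f w * g w) z = wirtinger s f z * g z + f z * wirtinger s g z := by
  simp only [wirtinger, fderiv_fun_mul hf hg, add_apply,
    smul_apply, smul_eq_mul]
  ring

lemma conj_wirtinger {f : ℂ → ℂ} {z : ℂ} (s : ℂ) (hf : DifferentiableAt ℝ f z) :
    conj (wirtinger s f z) = wirtinger (conj s) (fun w => conj (f w)) z := by
  have : fderiv ℝ (fun w => conj (f w)) z = (Complex.conjCLE : ℂ →L[ℝ] ℂ).comp (fderiv ℝ f z) :=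
    (Complex.conjCLE.hasFDerivAt.comp z hf.hasFDerivAt).fderiv
  simp only [wirtinger, this, map_mul, map_add, map_div₀, map_one, map_ofNat]
  rfl

lemma hasFDerivAt_gaussianSymbol (t z : ℂ) :
    HasFDerivAt (gaussianSymbol t)
      (((1 / 2 : ℂ) * (1 + conj t * Complex.I)) • (Complex.conjCLE : ℂ →L[ℝ] ℂ)
        + ((1 / 2 : ℂ) * (1 - conj t * Complex.I)) • ContinuousLinearMap.id ℝ ℂ) z :=
  ((Complex.conjCLE.hasFDerivAt (x := z)).const_mul _).add ((hasFDerivAt_id z).const_mul _)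

lemma wirtinger_gaussianSymbol (s t z : ℂ) :
    wirtinger s (gaussianSymbol t) z = (1 / 2 : ℂ) * (1 + conj t * s) := by
  simp only [wirtinger, (hasFDerivAt_gaussianSymbol t z).fderiv]
  simp
  linear_combination (-1 * conj t * s) * Complex.I_sq

lemma wirtinger_gaussianWeight (t z : ℂ) :
    wirtinger (conj t) gaussianWeight z = -(gaussianSymbol t z * gaussianWeight z) := by
  have h : HasFDerivAt gaussianWeight (Complex.ofRealCLM.comp
      (Real.exp (-‖z‖ ^ 2) • -(2 • innerSL ℝ z))) z :=
    Complex.ofRealCLM.hasFDerivAt.comp z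
      ((hasStrictFDerivAt_norm_sq z).hasFDerivAt.neg.exp)
  simp only [wirtinger, h.fderiv, gaussianSymbol, gaussianWeight]
  have e : z = z.re + z.im * Complex.I := (Complex.re_add_im z).symm
  have e' : conj z = z.re - z.im * Complex.I := Complex.ext (by simp) (by simp)
  rw [e']
  simp
  linear_combination (2⁻¹ * (1 - conj t * Complex.I) * cexp (-(‖z‖ : ℂ) ^ 2)) * e
    - (cexp (-(‖z‖ : ℂ) ^ 2) * conj t * z.im) * Complex.I_sq

lemma wirtinger_comm {f : ℂ → ℂ} (hf : ContDiff ℝ (⊤ : ℕ∞) f) (s t : ℂ) :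
    wirtinger s (wirtinger t f) = wirtinger t (wirtinger s f) := by
  ext z
  have hd : DifferentiableAt ℝ (fderiv ℝ f) z :=
    ((hf.fderiv_right (m := (⊤ : ℕ∞)) le_rfl).differentiable (by simp)) z
  have key (r v : ℂ) : fderiv ℝ (wirtinger r f) z v = (1 / 2 : ℂ) *
      (fderiv ℝ (fderiv ℝ f) z v 1 + r * fderiv ℝ (fderiv ℝ f) z v Complex.I) := by
    have h₁ (w : ℂ) : HasFDerivAt (fun y => fderiv ℝ f y w)
        ((fderiv ℝ (fderiv ℝ f) z).flip w) z := by
      simpa using hd.hasFDerivAt.clm_apply (hasFDerivAt_const w z)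
    have h₂ := ((h₁ 1).add ((h₁ Complex.I).const_mul r)).const_mul (1 / 2 : ℂ)
    have := h₂.fderiv
    unfold wirtinger
    erw [this]
    simp [mul_add]
  have hs : fderiv ℝ (fderiv ℝ f) z 1 Complex.I = fderiv ℝ (fderiv ℝ f) z Complex.I 1 :=
    ((contDiff_infty.1 hf 2).contDiffAt.isSymmSndFDerivAt (by simp)) 1 Complex.I
  conv_lhs => unfold wirtinger
  conv_rhs => unfold wirtinger
  simp only [← wirtinger.eq_1, key, hs]
  ring

lemma contDiff_wirtinger {f : ℂ → ℂ} (hf : ContDiff ℝ (⊤ : ℕ∞) f) (s : ℂ) :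
    ContDiff ℝ (⊤ : ℕ∞) (wirtinger s f) := by
  have := hf.fderiv_right (m := (⊤ : ℕ∞)) le_rfl
  unfold wirtinger
  fun_prop

lemma hasCompactSupport_wirtinger {f : ℂ → ℂ} (hf : HasCompactSupport f) (s : ℂ) :
    HasCompactSupport (wirtinger s f) :=
  ((hf.fderiv_apply (𝕜 := ℝ) 1).add ((hf.fderiv_apply (𝕜 := ℝ) Complex.I).mul_left)).mul_left

lemma integral_wirtinger_eq_zero {f : ℂ → ℂ} (hf : ContDiff ℝ (⊤ : ℕ∞) f)
    (hc : HasCompactSupport f) (s : ℂ) : ∫ z, wirtinger s f z = 0 := by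
  have hi (v : ℂ) : Integrable (fun z => fderiv ℝ f z v) :=
    ((hf.continuous_fderiv (by simp)).clm_apply continuous_const).integrable_of_hasCompactSupport
      (hc.fderiv_apply (𝕜 := ℝ) v)
  have h₀ (v : ℂ) : ∫ z, fderiv ℝ f z v = 0 := by
    have := integral_mul_fderiv_eq_neg_fderiv_mul_of_integrable (μ := volume)
      (f := fun _ : ℂ => (1 : ℂ)) (g := f) (v := v) (by simp)
      (by simpa using hi v) (by simpa using hf.continuous.integrable_of_hasCompactSupport hc)
      (by simp) (fun x _ => hf.differentiable (by simp) x)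
    simpa using this
  unfold wirtinger
  rw [integral_const_mul, integral_add (hi 1) ((hi _).const_mul s), integral_const_mul, h₀, h₀]
  simp

/-- Smooth compactly supported functions on `ℂ`. -/
def smoothCompact : Submodule ℂ (ℂ → ℂ) where
  carrier := {f | ContDiff ℝ (⊤ : ℕ∞) f ∧ HasCompactSupport f}
  add_mem' hf hg := ⟨hf.1.add hg.1, hf.2.add hg.2⟩
  zero_mem' := ⟨contDiff_const, HasCompactSupport.zero⟩
  smul_mem' c _ hf := ⟨contDiff_const.smul hf.1, hf.2.smul_left (f := fun _ => c)⟩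

namespace smoothCompact

lemma differentiableAt (ψ : smoothCompact) (z : ℂ) : DifferentiableAt ℝ ψ.1 z :=
  ψ.2.1.differentiable (by simp) z

/-- Multiplication by a smooth function on `smoothCompact`. -/
noncomputable def mulLeft (m : ℂ → ℂ) (hm : ContDiff ℝ (⊤ : ℕ∞) m) :
    Module.End ℂ smoothCompact where
  toFun ψ := ⟨fun z => m z * ψ.1 z, hm.mul ψ.2.1, ψ.2.2.mul_left⟩
  map_add' ψ χ := by ext z; simp [mul_add]
  map_smul' c ψ := by ext z; simp [mul_left_comm]

/-- `wirtinger s` on `smoothCompact`. -/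
noncomputable def lower (s : ℂ) : Module.End ℂ smoothCompact where
  toFun ψ := ⟨wirtinger s ψ.1, contDiff_wirtinger ψ.2.1 s, hasCompactSupport_wirtinger ψ.2.2 s⟩
  map_add' ψ χ := by
    ext z
    simp [wirtinger, fderiv_add (smoothCompact.differentiableAt ψ z) (smoothCompact.differentiableAt χ z)]
    ring
  map_smul' c ψ := by
    ext z
    simp [wirtinger, fderiv_const_smul (smoothCompact.differentiableAt ψ z)]
    ring

/-- The formal adjoint of `lower t` for the Gaussian weight. -/
noncomputable def raise (t : ℂ) : Module.End ℂ smoothCompact :=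
  mulLeft (gaussianSymbol t) (contDiff_gaussianSymbol t) - lower (conj t)

lemma raise_apply (t : ℂ) (ψ : smoothCompact) (z : ℂ) :
    (raise t ψ).1 z = gaussianSymbol t z * ψ.1 z - wirtinger (conj t) ψ.1 z := rfl

lemma lower_raise (s t : ℂ) (ψ : smoothCompact) :
    lower s (raise t ψ) = raise t (lower s ψ) + ((1 / 2 : ℂ) * (1 + conj t * s)) • ψ := by
  have h₁ : lower s (mulLeft _ (contDiff_gaussianSymbol t) ψ)
      = mulLeft _ (contDiff_gaussianSymbol t) (lower s ψ)
        + ((1 / 2 : ℂ) * (1 + conj t * s)) • ψ := by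
    ext z
    refine (wirtinger_mul s ((contDiff_gaussianSymbol t).differentiable (by simp) z)
      (smoothCompact.differentiableAt ψ z)).trans ?_
    rw [wirtinger_gaussianSymbol, add_comm]
    rfl
  have h₂ : lower s (lower (conj t) ψ) = lower (conj t) (lower s ψ) :=
    Subtype.ext (wirtinger_comm ψ.2.1 s (conj t))
  simp only [raise, LinearMap.sub_apply, map_sub, h₁, h₂]
  abel

lemma wirtinger_gaussianWeight_mul (t : ℂ) (ψ : smoothCompact) :
    wirtinger (conj t) (fun z => gaussianWeight z * ψ.1 z)
      = fun z => gaussianWeight z * (-raise t ψ : smoothCompact).1 z := by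
  ext z
  rw [wirtinger_mul _ (contDiff_gaussianWeight.differentiable (by simp) z) (smoothCompact.differentiableAt ψ z),
    wirtinger_gaussianWeight]
  change _ = gaussianWeight z * -((raise t ψ).1 z)
  rw [raise_apply]
  ring

lemma iterate_wirtinger_gaussianWeight_mul (t : ℂ) (k : ℕ) (ψ : smoothCompact) :
    (wirtinger (conj t))^[k] (fun z => gaussianWeight z * ψ.1 z)
      = fun z => gaussianWeight z * (((-raise t) ^ k) ψ).1 z := by
  induction k generalizing ψ with
  | zero => rfl
  | succ k ih =>
    rw [Function.iterate_succ_apply, wirtinger_gaussianWeight_mul, ih, pow_succ]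
    rfl

lemma Dk_gaussianWeight_mul (k : ℕ) (ψ : smoothCompact) :
    Dk k (fun z => gaussianWeight z * ψ.1 z) = fun z => gaussianWeight z *
      ((raise Complex.I ^ k) ((raise (-Complex.I) ^ k) ψ)).1 z := by
  have h₁ := iterate_wirtinger_gaussianWeight_mul (-Complex.I) k
  have h₂ := iterate_wirtinger_gaussianWeight_mul Complex.I k
  simp only [map_neg, Complex.conj_I, neg_neg] at h₁ h₂
  rw [Dk, wD_eq_wirtinger, wDbar_eq_wirtinger, h₁, h₂, neg_pow_apply, neg_pow_apply,
    map_smul, smul_smul, ← mul_pow]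
  simp

lemma memLp_mul (ψ : smoothCompact) {m : ℂ → ℂ} (hm : Continuous m) :
    MemLp (fun z => m z * ψ.1 z) 2 volume :=
  (hm.mul ψ.2.1.continuous).memLp_of_hasCompactSupport ψ.2.2.mul_left

/-- The function `e^{r|z|²}` with values in `ℂ`. -/
noncomputable def expNormSq (r : ℝ) (z : ℂ) : ℂ := (Real.exp (r * ‖z‖ ^ 2) : ℂ)

lemma continuous_expNormSq (r : ℝ) : Continuous (expNormSq r) :=
  (contDiff_ofReal_exp_mul_norm_sq r).continuous

/-- The map `ψ ↦ e^{-|z|²/2} ψ` into `L²(ℂ)`. -/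
noncomputable def toL2 : smoothCompact →ₗ[ℂ] Lp ℂ 2 (volume : Measure ℂ) where
  toFun ψ := (memLp_mul ψ (continuous_expNormSq (-1 / 2))).toLp
  map_add' ψ χ := by
    rw [← MemLp.toLp_add]
    congr 1
    ext z
    simp [mul_add]
  map_smul' c ψ := by
    rw [RingHom.id_apply, ← MemLp.toLp_const_smul]
    congr 1
    ext z
    simp [mul_left_comm]

lemma norm_expNormSq_sq (r : ℝ) (z : ℂ) :
    ‖expNormSq r z‖ ^ 2 = Real.exp (2 * r * ‖z‖ ^ 2) := by
  rw [expNormSq, Complex.norm_real, Real.norm_of_nonneg (Real.exp_nonneg _), ← Real.exp_nat_mul]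
  push_cast
  ring_nf

lemma norm_sq_eq_integral (v : Lp ℂ 2 (volume : Measure ℂ)) : ‖v‖ ^ 2 = ∫ z, ‖v z‖ ^ 2 := by
  have h : (inner ℂ v v : ℂ) = ((∫ z, ‖v z‖ ^ 2 : ℝ) : ℂ) := by
    rw [L2.inner_def, ← integral_complex_ofReal]
    simp [inner_self_eq_norm_sq_to_K]
  rw [inner_self_eq_norm_sq_to_K] at h
  exact Complex.ofReal_injective (by simpa using h)

lemma expNormSq_mul_self (z : ℂ) :
    expNormSq (-1 / 2) z * expNormSq (-1 / 2) z = gaussianWeight z := by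
  rw [expNormSq, gaussianWeight, ← Complex.ofReal_mul, ← Real.exp_add]
  ring_nf

lemma inner_toL2 (v : Lp ℂ 2 (volume : Measure ℂ)) (ψ : smoothCompact) :
    inner ℂ v (toL2 ψ) = ∫ z, conj (v z) * (expNormSq (-1 / 2) z * ψ.1 z) := by
  rw [L2.inner_def]
  refine integral_congr_ae ?_
  filter_upwards [(memLp_mul ψ (continuous_expNormSq (-1 / 2))).coeFn_toLp] with z hz
  have : (toL2 ψ : ℂ → ℂ) z = _ := hz
  rw [this, RCLike.inner_apply, mul_comm]

lemma inner_toL2_toL2 (ψ χ : smoothCompact) :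
    inner ℂ (toL2 ψ) (toL2 χ) = ∫ z, conj (ψ.1 z) * χ.1 z * gaussianWeight z := by
  rw [inner_toL2]
  refine integral_congr_ae ?_
  filter_upwards [(memLp_mul ψ (continuous_expNormSq (-1 / 2))).coeFn_toLp] with z hz
  have : (toL2 ψ : ℂ → ℂ) z = _ := hz
  rw [this, map_mul, ← expNormSq_mul_self, expNormSq, Complex.conj_ofReal]
  ring

lemma integrable_weight (ψ χ : smoothCompact) :
    Integrable (fun z => conj (ψ.1 z) * χ.1 z * gaussianWeight z) :=
  (((Complex.continuous_conj.comp ψ.2.1.continuous).mul χ.2.1.continuous).mul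
    contDiff_gaussianWeight.continuous).integrable_of_hasCompactSupport χ.2.2.mul_left.mul_right

lemma isLadder {t : ℂ} (ht : conj t * t = 1) : IsLadder toL2 (lower t) (raise t) where
  comm ψ := by
    rw [lower_raise, ht]
    norm_num
  adjoint ψ χ := by
    rw [inner_toL2_toL2, inner_toL2_toL2, ← sub_eq_zero, ← integral_sub]
    · have hψ : ContDiff ℝ (⊤ : ℕ∞) (fun z => conj (ψ.1 z)) :=
        Complex.conjCLE.contDiff.comp ψ.2.1
      have hF : ContDiff ℝ (⊤ : ℕ∞) (fun z => conj (ψ.1 z) * χ.1 z) := hψ.mul χ.2.1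
      rw [← integral_wirtinger_eq_zero (hF.mul contDiff_gaussianWeight)
        (χ.2.2.mul_left.mul_right) (conj t)]
      congr 1
      ext z
      rw [wirtinger_mul _ (hF.differentiable (by simp) z)
        (contDiff_gaussianWeight.differentiable (by simp) z),
        wirtinger_mul _ (hψ.differentiable (by simp) z) (smoothCompact.differentiableAt χ z),
        wirtinger_gaussianWeight, ← conj_wirtinger t (smoothCompact.differentiableAt ψ z), raise_apply]
      change conj (wirtinger t ψ.1 z) * _ * _ - _ = _
      ring
    · exact integrable_weight (lower t ψ) χ
    · exact integrable_weight ψ (raise t χ)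

end smoothCompact

end Wirtinger

open smoothCompact

/-- For every f ∈ L²(ℂ, e^{−|z|²}) there is a weak solution
u ∈ L²(ℂ, e^{−|z|²}) of ∂^k ∂̄^k u + c u = f with
∫ |u|² e^{−|z|²} ≤ (1/(k!)²) ∫ |f|² e^{−|z|²}. -/
theorem stmt0 (k : ℕ) (hk : 1 ≤ k) (c : ℂ) (f : ℂ → ℂ)
    (hf : MemL2w (fun z => ‖z‖ ^ 2) f) :
    ∃ u : ℂ → ℂ, MemL2w (fun z => ‖z‖ ^ 2) u ∧ IsWeakSol k c u f ∧
      normSqW (fun z => ‖z‖ ^ 2) u ≤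
        (1 / (k.factorial : ℝ) ^ 2) * normSqW (fun z => ‖z‖ ^ 2) f := by
  have hk0 : (0 : ℝ) < k.factorial := by positivity
  have hE : Continuous (expNormSq (-1 / 2)) := continuous_expNormSq _
  have hE' : Continuous (expNormSq (1 / 2)) := continuous_expNormSq _
  -- the data as an element of the unweighted `L²`
  have hgn (z : ℂ) : ‖starRingEnd ℂ (f z) * expNormSq (-1 / 2) z‖ ^ 2
      = ‖f z‖ ^ 2 * Real.exp (-(‖z‖ ^ 2)) := by
    rw [norm_mul, mul_pow, RCLike.norm_conj, norm_expNormSq_sq]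
    ring_nf
  have hg : MemLp (fun z => starRingEnd ℂ (f z) * expNormSq (-1 / 2) z) 2 volume := by
    refine (memLp_two_iff_integrable_sq_norm
      ((Complex.continuous_conj.comp_aestronglyMeasurable hf.1).mul hE.aestronglyMeasurable)).2 ?_
    exact hf.2.2.congr (ae_of_all _ fun z => (hgn z).symm)
  have hgnorm : ‖hg.toLp‖ ^ 2 = normSqW (fun z => ‖z‖ ^ 2) f := by
    rw [norm_sq_eq_integral]
    refine integral_congr_ae ?_
    filter_upwards [hg.coeFn_toLp] with z hz
    rw [hz, hgn]
  let P : Module.End ℂ smoothCompact :=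
    raise Complex.I ^ k * raise (-Complex.I) ^ k + c • LinearMap.id
  have hP (ψ : smoothCompact) : k.factorial * ‖toL2 ψ‖ ≤ ‖toL2 (P ψ)‖ := by
    refine (isLadder (t := Complex.I) (by simp)).factorial_mul_norm_le
      (isLadder (t := -Complex.I) (by simp)) ?_ hk c ψ
    ext1 ψ
    exact (lower_raise _ _ ψ).trans (by simp)
  obtain ⟨v, hv, hvP⟩ := exists_inner_eq_of_norm_le (toL2 ∘ₗ P)
    ((innerSL ℂ hg.toLp).toLinearMap ∘ₗ toL2) (C := ‖hg.toLp‖ / k.factorial) (by positivity)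
    (fun ψ => by
      refine (norm_inner_le_norm hg.toLp (toL2 ψ)).trans ?_
      rw [div_mul_eq_mul_div, mul_div_assoc]
      refine mul_le_mul_of_nonneg_left ?_ (norm_nonneg _)
      rw [le_div_iff₀ hk0, mul_comm]
      exact hP ψ)
  have hvL : MemLp v 2 volume := Lp.memLp v
  have hv2 : Integrable (fun z => ‖v z‖ ^ 2) :=
    (memLp_two_iff_integrable_sq_norm hvL.1).1 hvL
  have hun (z : ℂ) : ‖starRingEnd ℂ (v z) * expNormSq (1 / 2) z‖ ^ 2
      = ‖v z‖ ^ 2 * Real.exp (‖z‖ ^ 2) := by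
    rw [norm_mul, mul_pow, RCLike.norm_conj, norm_expNormSq_sq]
    ring_nf
  have hun' (z : ℂ) : ‖starRingEnd ℂ (v z) * expNormSq (1 / 2) z‖ ^ 2 * Real.exp (-(‖z‖ ^ 2))
      = ‖v z‖ ^ 2 := by
    rw [hun, mul_assoc, ← Real.exp_add, add_neg_cancel, Real.exp_zero, mul_one]
  refine ⟨fun z => starRingEnd ℂ (v z) * expNormSq (1 / 2) z, ⟨?_, ?_, ?_⟩, ?_, ?_⟩
  · exact (Complex.continuous_conj.comp_aestronglyMeasurable hvL.1).mul hE'.aestronglyMeasurable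
  · simp only [hun]
    rw [← locallyIntegrableOn_univ]
    exact (hv2.locallyIntegrable.locallyIntegrableOn _).mul_continuousOn
      (by fun_prop) isOpen_univ.isLocallyClosed
  · simpa only [hun'] using hv2
  · intro χ hχ hχc
    let ψ : smoothCompact := mulLeft (expNormSq 1) (contDiff_ofReal_exp_mul_norm_sq 1) ⟨χ, hχ, hχc⟩
    have hψ (z : ℂ) : gaussianWeight z * ψ.1 z = χ z := by
      change gaussianWeight z * (expNormSq 1 z * χ z) = χ z
      rw [← mul_assoc, gaussianWeight, expNormSq, ← Complex.ofReal_mul, ← Real.exp_add]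
      simp
    have hD (z : ℂ) : gaussianWeight z * (P ψ).1 z = Dk k χ z + c * χ z := by
      have h := congrFun (Dk_gaussianWeight_mul k ψ) z
      simp only [hψ] at h
      rw [h, ← hψ z]
      change gaussianWeight z * (_ + c * ψ.1 z) = _
      rw [mul_add, mul_left_comm c]
      rfl
    have hconj : MemLp (fun z => starRingEnd ℂ (v z)) 2 volume := hvL.star
    have hint {w : ℂ → ℂ} (hw : Continuous w) (hc : HasCompactSupport w) :
        Integrable (fun z => starRingEnd ℂ (v z) * expNormSq (1 / 2) z * w z) := by
      simp only [mul_assoc]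
      exact hconj.integrable_mul (q := 2)
        ((hE'.mul hw).memLp_of_hasCompactSupport hc.mul_left)
    let Aψ := (raise Complex.I ^ k) ((raise (-Complex.I) ^ k) ψ)
    have hDχ : Dk k χ = fun z => gaussianWeight z *
        Aψ.1 z := by
      rw [← Dk_gaussianWeight_mul]
      simp only [hψ]
    have hiD := hint (w := Dk k χ)
      (hDχ ▸ contDiff_gaussianWeight.continuous.mul Aψ.2.1.continuous)
      (hDχ ▸ Aψ.2.2.mul_left)
    rw [← integral_const_mul, ← integral_add hiD ((hint hχ.continuous hχc).const_mul c)]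
    have key := hvP ψ
    change inner ℂ v (toL2 (P ψ)) = inner ℂ hg.toLp (toL2 ψ) at key
    rw [inner_toL2, inner_toL2] at key
    refine Eq.trans (integral_congr_ae (ae_of_all _ fun z => ?_)) (key.trans
      (integral_congr_ae ?_))
    · have h : expNormSq (1 / 2) z * gaussianWeight z = expNormSq (-1 / 2) z := by
        rw [gaussianWeight, expNormSq, expNormSq, ← Complex.ofReal_mul, ← Real.exp_add]
        ring_nf
      dsimp only
      rw [← h]
      linear_combination (-starRingEnd ℂ (v z) * expNormSq (1 / 2) z) * hD z
    · filter_upwards [hg.coeFn_toLp] with z hz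
      rw [hz, map_mul, Complex.conj_conj, expNormSq, Complex.conj_ofReal, ← expNormSq, ← hψ z,
        ← expNormSq_mul_self]
      ring
  · rw [← hgnorm]
    simp only [normSqW, hun']
    rw [← norm_sq_eq_integral, one_div, inv_mul_eq_div, ← div_pow]
    gcongr
end

section
/- Let k ≥ 1 be an integer and take the weight φ(z) = |z|². For every ψ ∈ C_c^∞(ℂ), one has the pointwise identity [∂^k ∂̄^k(∂̄_φ^{k*}∂_φ^{k*} ψ) − ∂̄_φ^{k*}∂_φ^{k*}(∂^k ∂̄^k ψ)] e^{−|z|²} = Σ_{(l,m) ∈ {0,…,k}², (l,m) ≠ (0,0)} [(k!)⁴ / (l! m! ((k−l)!)² ((k−m)!)²)] (−1)^{l+m} ∂^{k−m} ∂̄^{k−l}((∂^{k−l} ∂̄^{k−m} ψ) e^{−|z|²}). -/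
open MeasureTheory Complex Finset

open scoped ContDiff

/-- Normal ordering in a ring: if `D Q = Q D - 1`, then
`D ^ n Q ^ m = ∑ l, (-1) ^ l (n)_l (m choose l) Q ^ (m - l) D ^ (n - l)`. -/
theorem pow_mul_pow_of_mul_eq_sub_one {A : Type*} [Ring A] {D Q : A} (h : D * Q = Q * D - 1)
    (n m : ℕ) :
    D ^ n * Q ^ m = ∑ l ∈ range (m + 1),
      ((-1) ^ l * (n.descFactorial l : ℤ) * (m.choose l : ℤ)) • (Q ^ (m - l) * D ^ (n - l)) := by
  have hD : ∀ j : ℕ, D ^ j * Q = Q * D ^ j - (j : ℤ) • D ^ (j - 1) := by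
    intro j
    induction j with
    | zero => simp
    | succ j ih =>
      rw [pow_succ, mul_assoc, h, mul_sub, ← mul_assoc, ih, sub_mul, smul_mul_assoc]
      rcases j with _ | j
      · simp
      · simp only [Nat.add_sub_cancel, ← pow_succ, mul_assoc, mul_one]
        push_cast
        module
  induction m with
  | zero => simp
  | succ m ih =>
    rw [pow_succ, ← mul_assoc, ih, sum_mul]
    have h1 : ∀ l ∈ range (m + 1),
        ((-1) ^ l * (n.descFactorial l : ℤ) * (m.choose l : ℤ)) • (Q ^ (m - l) * D ^ (n - l)) * Q
        = ((-1) ^ l * (n.descFactorial l : ℤ) * (m.choose l : ℤ)) •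
            (Q ^ (m + 1 - l) * D ^ (n - l))
          + ((-1) ^ (l + 1) * (n.descFactorial (l + 1) : ℤ) * (m.choose l : ℤ)) •
            (Q ^ (m - l) * D ^ (n - (l + 1))) := by
      intro l hl
      have hl' : l ≤ m := Nat.lt_succ_iff.mp (mem_range.mp hl)
      rw [smul_mul_assoc, mul_assoc (Q ^ _), hD, mul_sub, ← mul_assoc (Q ^ _), ← pow_succ,
        ← Nat.sub_add_comm hl', mul_smul_comm, Nat.descFactorial_succ, Nat.sub_sub]
      push_cast
      module
    rw [sum_congr rfl h1, sum_add_distrib, sum_range_succ' _ (m + 1)]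
    have h2 := sum_range_succ (fun l => ((-1) ^ l * (n.descFactorial l : ℤ) * (m.choose l : ℤ)) •
            (Q ^ (m + 1 - l) * D ^ (n - l))) (m + 1)
    rw [Nat.choose_succ_self, sum_range_succ'] at h2
    simp only [Nat.cast_zero, mul_zero, zero_smul, add_zero] at h2
    rw [← h2, add_right_comm, ← sum_add_distrib]
    congr 1
    · refine sum_congr rfl fun l _ => ?_
      rw [Nat.choose_succ_succ, Nat.add_sub_add_right]
      push_cast
      module
    · simp

theorem descFactorial_mul_choose_cast {k l : ℕ} (hl : l ≤ k) :
    (k.descFactorial l : ℂ) * (k.choose l : ℂ) =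
      (k.factorial : ℂ) ^ 2 / ((l.factorial : ℂ) * ((k - l).factorial : ℂ) ^ 2) := by
  have h1 : ((k - l).factorial : ℂ) * (k.descFactorial l : ℂ) = k.factorial := by
    exact_mod_cast Nat.factorial_mul_descFactorial hl
  have h2 : (k.choose l : ℂ) * (l.factorial : ℂ) * ((k - l).factorial : ℂ) = k.factorial := by
    exact_mod_cast Nat.choose_mul_factorial_mul_factorial hl
  have h3 : (l.factorial : ℂ) ≠ 0 := by exact_mod_cast l.factorial_ne_zero
  have h4 : ((k - l).factorial : ℂ) ≠ 0 := by exact_mod_cast (k - l).factorial_ne_zero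
  rw [eq_div_iff (by positivity), sq (k.factorial : ℂ)]
  nth_rewrite 1 [← h1]
  rw [← h2]
  ring

/-- The double normal ordering formula for two conjugate pairs `(D, Q)` and `(B, P)`. -/
theorem pow_mul_pow_mul_pow_mul_pow_eq_sum {A : Type*} [Ring A] [Algebra ℂ A] {D B P Q : A}
    (hDQ : D * Q = Q * D - 1) (hBP : B * P = P * B - 1) (hDP : Commute D P) (hBQ : Commute B Q)
    (k : ℕ) :
    D ^ k * B ^ k * (P ^ k * Q ^ k) = ∑ p ∈ range (k + 1) ×ˢ range (k + 1),
      ((k.factorial : ℂ) ^ 4 /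
              ((p.1.factorial : ℂ) * (p.2.factorial : ℂ) *
                ((k - p.1).factorial : ℂ) ^ 2 * ((k - p.2).factorial : ℂ) ^ 2) *
            (-1 : ℂ) ^ (p.1 + p.2)) •
        (P ^ (k - p.2) * Q ^ (k - p.1) * (D ^ (k - p.1) * B ^ (k - p.2))) := by
  have key : ∀ m, D ^ k * (P ^ (k - m) * B ^ (k - m)) * Q ^ k
      = P ^ (k - m) * (D ^ k * Q ^ k) * B ^ (k - m) := by
    intro m
    rw [← mul_assoc, (hDP.pow_pow k (k - m)).eq, mul_assoc, (hBQ.pow_pow (k - m) k).eq]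
    simp only [mul_assoc]
  calc D ^ k * B ^ k * (P ^ k * Q ^ k) = D ^ k * (B ^ k * P ^ k) * Q ^ k := by
        simp only [mul_assoc]
    _ = _ := by
      rw [pow_mul_pow_of_mul_eq_sub_one hBP, mul_sum, sum_mul, sum_product_right]
      refine sum_congr rfl fun m hm => ?_
      rw [mul_smul_comm, smul_mul_assoc, key, pow_mul_pow_of_mul_eq_sub_one hDQ, mul_sum, sum_mul,
        smul_sum]
      refine sum_congr rfl fun l hl => ?_
      have hl' := descFactorial_mul_choose_cast (Nat.lt_succ_iff.mp (mem_range.mp hl))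
      have hm' := descFactorial_mul_choose_cast (Nat.lt_succ_iff.mp (mem_range.mp hm))
      rw [mul_smul_comm, smul_mul_assoc, smul_smul, ← Int.cast_smul_eq_zsmul ℂ]
      simp only [mul_assoc]
      congr 1
      push_cast
      calc _ = (-1 : ℂ) ^ (l + m) * ((k.descFactorial l : ℂ) * (k.choose l : ℂ)) *
            ((k.descFactorial m : ℂ) * (k.choose m : ℂ)) := by ring
        _ = _ := by
          rw [hl', hm']
          field_simp

section Wirtinger

variable {f g : ℂ → ℂ}

theorem ContDiff.wD (hf : ContDiff ℝ ∞ f) : ContDiff ℝ ∞ (wD f) := by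
  have h := hf.fderiv_right (m := ∞) le_rfl
  unfold _root_.wD
  fun_prop

theorem ContDiff.wDbar (hf : ContDiff ℝ ∞ f) : ContDiff ℝ ∞ (wDbar f) := by
  have h := hf.fderiv_right (m := ∞) le_rfl
  unfold _root_.wDbar
  fun_prop

theorem wD_add (hf : Differentiable ℝ f) (hg : Differentiable ℝ g) :
    wD (f + g) = wD f + wD g := by
  ext z
  simp only [wD, fderiv_add (hf z) (hg z), Pi.add_apply, add_apply]
  ring

theorem wDbar_add (hf : Differentiable ℝ f) (hg : Differentiable ℝ g) :
    wDbar (f + g) = wDbar f + wDbar g := by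
  ext z
  simp only [wDbar, fderiv_add (hf z) (hg z), Pi.add_apply, add_apply]
  ring

theorem wD_mul (hf : Differentiable ℝ f) (hg : Differentiable ℝ g) :
    wD (f * g) = wD f * g + f * wD g := by
  ext z
  simp only [wD, fderiv_mul (hf z) (hg z), Pi.add_apply, Pi.mul_apply,
    add_apply, smul_apply, smul_eq_mul]
  ring

theorem wDbar_mul (hf : Differentiable ℝ f) (hg : Differentiable ℝ g) :
    wDbar (f * g) = wDbar f * g + f * wDbar g := by
  ext z
  simp only [wDbar, fderiv_mul (hf z) (hg z), Pi.add_apply, Pi.mul_apply,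
    add_apply, smul_apply, smul_eq_mul]
  ring

theorem wD_const_smul (c : ℂ) (hf : Differentiable ℝ f) : wD (c • f) = c • wD f := by
  ext z
  simp only [wD, fderiv_const_smul (hf z), Pi.smul_apply,
    smul_apply, smul_eq_mul]
  ring

theorem wDbar_const_smul (c : ℂ) (hf : Differentiable ℝ f) : wDbar (c • f) = c • wDbar f := by
  ext z
  simp only [wDbar, fderiv_const_smul (hf z), Pi.smul_apply,
    smul_apply, smul_eq_mul]
  ring

theorem wD_id : wD id = 1 := by
  ext z
  simp [wD]
  norm_num

theorem wDbar_id : wDbar id = 0 := by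
  ext z
  simp [wDbar]

theorem fderiv_conj (z : ℂ) : fderiv ℝ (starRingEnd ℂ : ℂ → ℂ) z = conjCLE :=
  conjCLE.hasFDerivAt.fderiv

theorem wD_conj : wD (starRingEnd ℂ) = 0 := by
  ext z
  simp [wD, fderiv_conj]

theorem wDbar_conj : wDbar (starRingEnd ℂ) = 1 := by
  ext z
  simp [wDbar, fderiv_conj]
  norm_num

theorem wD_cexp (hf : Differentiable ℝ f) :
    wD (fun z => exp (f z)) = (fun z => exp (f z)) * wD f := by
  ext z
  simp only [wD, (hf z).hasFDerivAt.cexp.fderiv, Pi.mul_apply,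
    smul_apply, smul_eq_mul]
  ring

theorem wDbar_cexp (hf : Differentiable ℝ f) :
    wDbar (fun z => exp (f z)) = (fun z => exp (f z)) * wDbar f := by
  ext z
  simp only [wDbar, (hf z).hasFDerivAt.cexp.fderiv, Pi.mul_apply,
    smul_apply, smul_eq_mul]
  ring

theorem wD_wDbar_comm (hf : ContDiff ℝ ∞ f) : wD (wDbar f) = wDbar (wD f) := by
  have hd : Differentiable ℝ (fderiv ℝ f) :=
    (hf.fderiv_right (m := ∞) le_rfl).differentiable (by simp)
  ext z
  have hv : ∀ v : ℂ, HasFDerivAt (fun w => fderiv ℝ f w v)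
      ((fderiv ℝ (fderiv ℝ f) z).flip v) z := fun v => by
    simpa using (hd z).hasFDerivAt.clm_apply (hasFDerivAt_const v z)
  have hsymm : fderiv ℝ (fderiv ℝ f) z 1 I = fderiv ℝ (fderiv ℝ f) z I 1 :=
    (hf.contDiffAt.isSymmSndFDerivAt (by simp; exact WithTop.coe_le_coe.2 le_top)).eq 1 I
  have h1 := (((hv 1).add ((hv I).const_mul I)).const_mul (1 / 2 : ℂ)).fderiv
  have h2 := (((hv 1).sub ((hv I).const_mul I)).const_mul (1 / 2 : ℂ)).fderiv
  simp only [Pi.add_def, Pi.sub_def] at h1 h2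
  unfold wD wDbar
  rw [h1, h2]
  simp [hsymm]
  ring

end Wirtinger

/-- The complex subspace of the functions `ℂ → ℂ` that are smooth over the reals. -/
def smoothSubmodule : Submodule ℂ (ℂ → ℂ) where
  carrier := {f | ContDiff ℝ ∞ f}
  add_mem' {f g} (hf : ContDiff ℝ ∞ f) (hg : ContDiff ℝ ∞ g) :=
    show ContDiff ℝ ∞ (f + g) from hf.add hg
  zero_mem' := show ContDiff ℝ ∞ (fun _ : ℂ => (0 : ℂ)) from contDiff_const
  smul_mem' c f (hf : ContDiff ℝ ∞ f) := show ContDiff ℝ ∞ (c • f) from hf.const_smul c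

/-- The smooth functions on `ℂ`, as a type of its own so that the ring structure of its
endomorphisms is found through `SmoothFun` and not through the function space. -/
def SmoothFun : Type := smoothSubmodule

noncomputable instance : AddCommGroup SmoothFun := inferInstanceAs (AddCommGroup smoothSubmodule)

noncomputable instance : Module ℂ SmoothFun := inferInstanceAs (Module ℂ smoothSubmodule)

namespace SmoothFun

/-- The underlying function of a smooth function. -/
noncomputable def coeLin : SmoothFun →ₗ[ℂ] (ℂ → ℂ) := smoothSubmodule.subtype

noncomputable instance : Coe SmoothFun (ℂ → ℂ) := ⟨coeLin⟩

/-- Bundle a smooth function. -/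
def mk (f : ℂ → ℂ) (hf : ContDiff ℝ ∞ f) : SmoothFun := Subtype.mk f hf

theorem ext_coe {f g : SmoothFun} (h : (f : ℂ → ℂ) = g) : f = g := Subtype.ext h

theorem contDiff_coe (f : SmoothFun) : ContDiff ℝ ∞ (f : ℂ → ℂ) := f.2

theorem differentiable_coe (f : SmoothFun) : Differentiable ℝ (f : ℂ → ℂ) :=
  (contDiff_coe f).differentiable (by simp)

/-- `∂` as an endomorphism of the smooth functions. -/
noncomputable def del : Module.End ℂ SmoothFun where
  toFun f := mk (wD f) ((contDiff_coe f).wD)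
  map_add' f g := ext_coe (wD_add (differentiable_coe f) (differentiable_coe g))
  map_smul' c f := ext_coe (wD_const_smul c (differentiable_coe f))

/-- `∂̄` as an endomorphism of the smooth functions. -/
noncomputable def delbar : Module.End ℂ SmoothFun where
  toFun f := mk (wDbar f) ((contDiff_coe f).wDbar)
  map_add' f g := ext_coe (wDbar_add (differentiable_coe f) (differentiable_coe g))
  map_smul' c f := ext_coe (wDbar_const_smul c (differentiable_coe f))

/-- Multiplication by a smooth function. -/
noncomputable def mulBy (h : SmoothFun) : Module.End ℂ SmoothFun where
  toFun f := mk ((h : ℂ → ℂ) * f) ((contDiff_coe h).mul (contDiff_coe f))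
  map_add' f g := ext_coe (mul_add (h : ℂ → ℂ) f g)
  map_smul' c f := ext_coe (mul_smul_comm c (h : ℂ → ℂ) f)

/-- The coordinate function `z`. -/
def coord : SmoothFun := mk id contDiff_id

/-- The conjugate coordinate function `z̄`. -/
noncomputable def coordConj : SmoothFun := mk (starRingEnd ℂ) conjCLE.contDiff

/-- The twisted derivative `∂ - z̄`, that is `f ↦ e^{|z|²} ∂ (f e^{-|z|²})`. -/
noncomputable def twistedDel : Module.End ℂ SmoothFun := del - mulBy coordConj

/-- The twisted derivative `∂̄ - z`, that is `f ↦ e^{|z|²} ∂̄ (f e^{-|z|²})`. -/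
noncomputable def twistedDelbar : Module.End ℂ SmoothFun := delbar - mulBy coord

theorem del_mul_mulBy (h : SmoothFun) : del * mulBy h = mulBy (del h) + mulBy h * del := by
  ext1 f
  exact ext_coe (wD_mul (differentiable_coe h) (differentiable_coe f))

theorem delbar_mul_mulBy (h : SmoothFun) :
    delbar * mulBy h = mulBy (delbar h) + mulBy h * delbar := by
  ext1 f
  exact ext_coe (wDbar_mul (differentiable_coe h) (differentiable_coe f))

theorem mulBy_eq_zero {h : SmoothFun} (hh : (h : ℂ → ℂ) = 0) : mulBy h = 0 := by
  ext1 f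
  refine ext_coe ?_
  change (h : ℂ → ℂ) * f = 0
  rw [hh, zero_mul]

theorem mulBy_eq_one {h : SmoothFun} (hh : (h : ℂ → ℂ) = 1) : mulBy h = 1 := by
  ext1 f
  refine ext_coe ?_
  change (h : ℂ → ℂ) * f = f
  rw [hh, one_mul]

theorem del_mul_delbar : del * delbar = delbar * del := by
  ext1 f
  exact ext_coe (wD_wDbar_comm (contDiff_coe f))

theorem commute_del_twistedDel : Commute del twistedDel := by
  rw [Commute, SemiconjBy, twistedDel, mul_sub, del_mul_mulBy, mulBy_eq_zero (h := del coordConj)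
    wD_conj, zero_add, sub_mul]

theorem commute_delbar_twistedDelbar : Commute delbar twistedDelbar := by
  rw [Commute, SemiconjBy, twistedDelbar, mul_sub, delbar_mul_mulBy,
    mulBy_eq_zero (h := delbar coord) wDbar_id, zero_add, sub_mul]

theorem del_mul_twistedDelbar : del * twistedDelbar = twistedDelbar * del - 1 := by
  rw [twistedDelbar, mul_sub, del_mul_mulBy, mulBy_eq_one (h := del coord) wD_id, sub_mul,
    del_mul_delbar]
  abel

theorem delbar_mul_twistedDel : delbar * twistedDel = twistedDel * delbar - 1 := by
  rw [twistedDel, mul_sub, delbar_mul_mulBy, mulBy_eq_one (h := delbar coordConj) wDbar_conj,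
    sub_mul, del_mul_delbar]
  abel

theorem coe_del_pow (n : ℕ) (f : SmoothFun) : ((del ^ n) f : ℂ → ℂ) = wD^[n] f := by
  induction n with
  | zero => rfl
  | succ n ih => rw [pow_succ', Function.iterate_succ_apply', ← ih]; rfl

theorem coe_delbar_pow (n : ℕ) (f : SmoothFun) : ((delbar ^ n) f : ℂ → ℂ) = wDbar^[n] f := by
  induction n with
  | zero => rfl
  | succ n ih => rw [pow_succ', Function.iterate_succ_apply', ← ih]; rfl

/-- The Gaussian `e^{-|z|²}`. -/
noncomputable def gaussian : ℂ → ℂ := fun z => (Real.exp (-‖z‖ ^ 2) : ℂ)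

theorem gaussian_eq :
    gaussian = fun z => exp (((-1 : ℂ) • (id * (starRingEnd ℂ : ℂ → ℂ)) : ℂ → ℂ) z) := by
  ext z
  simp [gaussian, mul_conj, normSq_eq_norm_sq]

theorem differentiable_conj : Differentiable ℝ (starRingEnd ℂ : ℂ → ℂ) := conjCLE.differentiable

theorem differentiable_neg_id_mul_conj :
    Differentiable ℝ ((-1 : ℂ) • (id * (starRingEnd ℂ : ℂ → ℂ))) :=
  (differentiable_id.mul differentiable_conj).const_smul _

theorem differentiable_gaussian : Differentiable ℝ gaussian := by
  rw [gaussian_eq]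
  exact differentiable_neg_id_mul_conj.cexp

theorem wD_gaussian : wD gaussian = -((starRingEnd ℂ : ℂ → ℂ) * gaussian) := by
  rw [gaussian_eq, wD_cexp differentiable_neg_id_mul_conj,
    wD_const_smul _ (differentiable_id.mul differentiable_conj),
    wD_mul differentiable_id differentiable_conj, wD_id, wD_conj]
  ext z
  simp
  ring

theorem wDbar_gaussian : wDbar gaussian = -(id * gaussian) := by
  rw [gaussian_eq, wDbar_cexp differentiable_neg_id_mul_conj,
    wDbar_const_smul _ (differentiable_id.mul differentiable_conj),
    wDbar_mul differentiable_id differentiable_conj, wDbar_id, wDbar_conj]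
  ext z
  simp
  ring

theorem wD_mul_gaussian (f : SmoothFun) :
    wD ((f : ℂ → ℂ) * gaussian) = (twistedDel f : ℂ → ℂ) * gaussian := by
  rw [wD_mul (differentiable_coe f) differentiable_gaussian, wD_gaussian]
  change _ = (wD f - (starRingEnd ℂ : ℂ → ℂ) * f) * gaussian
  ring

theorem wDbar_mul_gaussian (f : SmoothFun) :
    wDbar ((f : ℂ → ℂ) * gaussian) = (twistedDelbar f : ℂ → ℂ) * gaussian := by
  rw [wDbar_mul (differentiable_coe f) differentiable_gaussian, wDbar_gaussian]
  change _ = (wDbar f - (id : ℂ → ℂ) * (f : ℂ → ℂ)) * gaussian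
  ring

theorem iterate_wD_mul_gaussian (n : ℕ) (f : SmoothFun) :
    wD^[n] ((f : ℂ → ℂ) * gaussian) = ((twistedDel ^ n) f : ℂ → ℂ) * gaussian := by
  induction n with
  | zero => rfl
  | succ n ih =>
    rw [pow_succ', Function.iterate_succ_apply', ih, wD_mul_gaussian, Module.End.mul_apply]

theorem iterate_wDbar_mul_gaussian (n : ℕ) (f : SmoothFun) :
    wDbar^[n] ((f : ℂ → ℂ) * gaussian) = ((twistedDelbar ^ n) f : ℂ → ℂ) * gaussian := by
  induction n with
  | zero => rfl
  | succ n ih =>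
    rw [pow_succ', Function.iterate_succ_apply', ih, wDbar_mul_gaussian, Module.End.mul_apply]

theorem iterate_wD_iterate_wDbar (m n : ℕ) (f : SmoothFun) :
    wD^[m] (wDbar^[n] f) = ((del ^ m * delbar ^ n) f : ℂ → ℂ) := by
  rw [Module.End.mul_apply, coe_del_pow, coe_delbar_pow]

theorem iterate_wD_iterate_wDbar_mul_gaussian (m n : ℕ) (f : SmoothFun) :
    wD^[m] (wDbar^[n] ((f : ℂ → ℂ) * gaussian)) =
      ((twistedDel ^ m * twistedDelbar ^ n) f : ℂ → ℂ) * gaussian := by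
  rw [Module.End.mul_apply, iterate_wDbar_mul_gaussian, iterate_wD_mul_gaussian]

theorem adjOp_norm_sq (k : ℕ) (f : SmoothFun) :
    adjOp k (fun w => ‖w‖ ^ 2) f = ((twistedDel ^ k * twistedDelbar ^ k) f : ℂ → ℂ) := by
  ext z
  have h := congrFun (iterate_wD_iterate_wDbar_mul_gaussian k k f) z
  change (Real.exp (‖z‖ ^ 2) : ℂ) * wD^[k] (wDbar^[k] ((f : ℂ → ℂ) * gaussian)) z = _
  rw [h, Pi.mul_apply, mul_left_comm, gaussian, ← ofReal_mul, ← Real.exp_add]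
  simp

end SmoothFun

/-- with the weight φ(z) = |z|², one has the pointwise identity
[∂^k ∂̄^k(∂̄_φ^{k*}∂_φ^{k*} ψ) − ∂̄_φ^{k*}∂_φ^{k*}(∂^k ∂̄^k ψ)] e^{−|z|²}
  = Σ_{(l,m)≠(0,0)} [(k!)⁴/(l! m! ((k−l)!)² ((k−m)!)²)] (−1)^{l+m}
      ∂^{k−m}∂̄^{k−l}((∂^{k−l}∂̄^{k−m} ψ) e^{−|z|²}). -/
theorem stmt5 (k : ℕ) (hk : 1 ≤ k)
    (ψ : ℂ → ℂ) (hψ : ContDiff ℝ (⊤ : ℕ∞) ψ) (hψc : HasCompactSupport ψ) :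
    ∀ z : ℂ,
      (Dk k (adjOp k (fun w => ‖w‖ ^ 2) ψ) z -
          adjOp k (fun w => ‖w‖ ^ 2) (Dk k ψ) z) * (Real.exp (-‖z‖ ^ 2) : ℂ) =
        ∑ p ∈ (Finset.range (k + 1) ×ˢ Finset.range (k + 1)).filter
            (fun p => p ≠ (0, 0)),
          ((k.factorial : ℂ) ^ 4 /
              ((p.1.factorial : ℂ) * (p.2.factorial : ℂ) *
                ((k - p.1).factorial : ℂ) ^ 2 * ((k - p.2).factorial : ℂ) ^ 2)) *
            (-1 : ℂ) ^ (p.1 + p.2) *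
            (wD^[k - p.2] (wDbar^[k - p.1]
              (fun w => wD^[k - p.1] (wDbar^[k - p.2] ψ) w *
                (Real.exp (-‖w‖ ^ 2) : ℂ))) z) := by
  intro z
  obtain ⟨ψ, rfl⟩ : ∃ f : SmoothFun, (f : ℂ → ℂ) = ψ := ⟨SmoothFun.mk ψ hψ, rfl⟩
  have hDk : ∀ f : SmoothFun, Dk k f = ((SmoothFun.del ^ k * SmoothFun.delbar ^ k) f : ℂ → ℂ) :=
    SmoothFun.iterate_wD_iterate_wDbar k k
  have hterm : ∀ l m : ℕ, wD^[k - m] (wDbar^[k - l] (fun w => wD^[k - l] (wDbar^[k - m] ψ) w *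
        (Real.exp (-‖w‖ ^ 2) : ℂ))) z =
      ((SmoothFun.twistedDel ^ (k - m) * SmoothFun.twistedDelbar ^ (k - l) *
        (SmoothFun.del ^ (k - l) * SmoothFun.delbar ^ (k - m))) ψ : ℂ → ℂ) z *
        SmoothFun.gaussian z := by
    intro l m
    rw [SmoothFun.iterate_wD_iterate_wDbar]
    exact congrFun (SmoothFun.iterate_wD_iterate_wDbar_mul_gaussian _ _ _) z
  rw [SmoothFun.adjOp_norm_sq, hDk, hDk, SmoothFun.adjOp_norm_sq, ← Module.End.mul_apply,
    ← Module.End.mul_apply, pow_mul_pow_mul_pow_mul_pow_eq_sum SmoothFun.del_mul_twistedDelbar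
      SmoothFun.delbar_mul_twistedDel SmoothFun.commute_del_twistedDel
      SmoothFun.commute_delbar_twistedDelbar]
  simp only [hterm]
  change (_ - _) * SmoothFun.gaussian z = _
  have h0 : ((0, 0) : ℕ × ℕ) ∈ range (k + 1) ×ˢ range (k + 1) := by simp
  rw [filter_ne', ← add_sum_erase _ _ h0]
  have hk0 : (k.factorial : ℂ) ≠ 0 := by exact_mod_cast k.factorial_ne_zero
  simp only [LinearMap.add_apply, LinearMap.sum_apply, LinearMap.smul_apply, map_add,
    map_sum, map_smul, Pi.add_apply, Finset.sum_apply, Pi.smul_apply,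
    smul_eq_mul, Nat.sub_zero, add_mul, sub_mul, sum_mul]
  have hc : (k.factorial : ℂ) ^ 4 / (((0 : ℕ).factorial : ℂ) * ((0 : ℕ).factorial : ℂ) *
      (k.factorial : ℂ) ^ 2 * (k.factorial : ℂ) ^ 2) * (-1 : ℂ) ^ (0 + 0) = 1 := by
    simp
    field_simp
  rw [hc, one_mul, add_sub_cancel_left]
  exact sum_congr rfl fun p _ => by ring
end
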